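/- (Aleksandrov, Golinskii.) Let μ be a nontrivial probability measure on the unit circle, and for λ ∈ ∂𝔻 let μ_λ be the member of the Aleksandrov family of μ, i.e., the unique probability measure with Verblunsky coefficients α_j(dμ_λ) = λ·α_j(dμ). Then averaging over λ gives normalized Lebesgue measure: for every continuous function g on ∂𝔻, ∫_0^{2π} (∫ g(e^{iφ}) dμ_{e^{iθ}}(φ)) dθ/2π = ∫_0^{2π} g(e^{iφ}) dφ/2π. -/

import Mathlib

open MeasureTheory Polynomial Filter

noncomputable section

/-- A nontrivial probability measure on the unit circle: a probability measure on `ℂ`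
supported on `{z : ‖z‖ = 1}` that is not concentrated on any finite set
(equivalently, its support is infinite). -/
structure IsNontrivialOnCircle (μ : Measure ℂ) : Prop where
  prob : IsProbabilityMeasure μ
  onCircle : μ {z : ℂ | ‖z‖ = 1}ᶜ = 0
  infiniteSupport : ∀ s : Finset ℂ, μ ((↑s : Set ℂ)ᶜ) ≠ 0

/-- `Φ` is the family of monic orthogonal polynomials for `μ`: each `Φ n` is monic of
degree `n` and orthogonal in `L²(∂𝔻, dμ)` to `z^j` for `j = 0, …, n-1`. -/
def IsMonicOPUC (μ : Measure ℂ) (Φ : ℕ → Polynomial ℂ) : Prop :=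
  ∀ n : ℕ, ((Φ n).Monic ∧ (Φ n).natDegree = n) ∧
    ∀ j < n, ∫ z, (starRingEnd ℂ) z ^ j * (Φ n).eval z ∂μ = 0

/-- Verblunsky coefficients: `α n = -conj (Φ (n+1) (0))`. -/
def verblunsky (Φ : ℕ → Polynomial ℂ) (n : ℕ) : ℂ :=
  - (starRingEnd ℂ) ((Φ (n + 1)).eval 0)

/-- Squared `L²(dμ)` norm of a polynomial. -/
def polyNormSq (μ : Measure ℂ) (P : Polynomial ℂ) : ℝ :=
  ∫ z, ‖P.eval z‖ ^ 2 ∂μ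

/-- Orthonormal polynomial: `φ = Φ / ‖Φ‖_{L²(dμ)}`. -/
def orthonormalize (μ : Measure ℂ) (P : Polynomial ℂ) : Polynomial ℂ :=
  Polynomial.C ((Real.sqrt (polyNormSq μ P) : ℂ))⁻¹ * P

/-- The reversed polynomial `P^{*,n}(z) = z^n conj (P (1/conj z))`. -/
def revStar (n : ℕ) (P : Polynomial ℂ) : Polynomial ℂ :=
  ∑ j ∈ Finset.range (n + 1),
    Polynomial.C ((starRingEnd ℂ) (P.coeff (n - j))) * Polynomial.X ^ j

namespace IsNontrivialOnCircle

variable {μ : Measure ℂ}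

theorem ae_norm_eq_one (hμ : IsNontrivialOnCircle μ) : ∀ᵐ z ∂μ, ‖z‖ = 1 :=
  ae_iff.2 hμ.onCircle

theorem integrable_of_continuous (hμ : IsNontrivialOnCircle μ) {f : ℂ → ℂ}
    (hf : Continuous f) : Integrable f μ := by
  have := hμ.prob
  obtain ⟨C, hC⟩ := (isCompact_sphere (0 : ℂ) 1).exists_bound_of_continuousOn hf.continuousOn
  refine Integrable.of_bound hf.aestronglyMeasurable C ?_
  filter_upwards [hμ.ae_norm_eq_one] with z hz
  exact hC z (by simpa using hz)

/-- A polynomial orthogonal to each monomial it contains vanishes. -/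
theorem eq_zero_of_orthogonal (hμ : IsNontrivialOnCircle μ) (R : ℂ[X])
    (h : ∀ j ∈ R.support, ∫ z, (starRingEnd ℂ) z ^ j * R.eval z ∂μ = 0) : R = 0 := by
  have hIntegral : ∫ z, ((‖R.eval z‖ ^ 2 : ℝ) : ℂ) ∂μ = 0 := by
    have hexp : ∀ z : ℂ, ((‖R.eval z‖ ^ 2 : ℝ) : ℂ) =
        ∑ j ∈ R.support, (starRingEnd ℂ) (R.coeff j) * ((starRingEnd ℂ) z ^ j * R.eval z) := by
      intro z
      have : (starRingEnd ℂ) (R.eval z) =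
          ∑ j ∈ R.support, (starRingEnd ℂ) (R.coeff j) * (starRingEnd ℂ) z ^ j := by
        rw [eval_eq_sum, Polynomial.sum, map_sum]
        simp
      push_cast
      rw [← Complex.conj_mul', this, Finset.sum_mul]
      simp only [mul_assoc]
    simp_rw [hexp]
    rw [integral_finsetSum]
    · refine Finset.sum_eq_zero fun j hj => ?_
      rw [integral_const_mul, h j hj, mul_zero]
    · exact fun j _ => hμ.integrable_of_continuous (by fun_prop)
  have hsq : Integrable (fun z => ‖R.eval z‖ ^ 2) μ := by
    have := (hμ.integrable_of_continuous
      (f := fun z => ((‖R.eval z‖ ^ 2 : ℝ) : ℂ)) (by fun_prop)).re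
    simpa only [RCLike.re_to_complex, Complex.ofReal_re] using this
  rw [integral_complex_ofReal, Complex.ofReal_eq_zero,
    integral_eq_zero_iff_of_nonneg (fun z => by positivity) hsq] at hIntegral
  by_contra hR
  apply hμ.infiniteSupport R.roots.toFinset
  have : ∀ᵐ z ∂μ, z ∈ (R.roots.toFinset : Set ℂ) := by
    filter_upwards [hIntegral] with z hz
    simpa [hR] using hz
  exact ae_iff.1 this

end IsNontrivialOnCircle

theorem eval_revStar {n : ℕ} {P : ℂ[X]} (hP : P.natDegree ≤ n) {z : ℂ} (hz : ‖z‖ = 1) :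
    (revStar n P).eval z = z ^ n * (starRingEnd ℂ) (P.eval z) := by
  have hzz : z * (starRingEnd ℂ) z = 1 := by simp [Complex.mul_conj', hz]
  rw [eval_eq_sum_range' (Nat.lt_succ_of_le hP), map_sum, Finset.mul_sum, revStar,
    eval_finsetSum, ← Finset.sum_range_reflect]
  refine Finset.sum_congr rfl fun j hj => ?_
  have hj' : j ≤ n := by simpa [Nat.lt_succ_iff] using hj
  have h1 : n + 1 - 1 - j = n - j := by omega
  have h2 : n - (n - j) = j := by omega
  have h3 : z ^ n = z ^ (n - j) * z ^ j := by rw [← pow_add]; congr 1; omega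
  have h4 : z ^ j * (starRingEnd ℂ) z ^ j = 1 := by rw [← mul_pow, hzz, one_pow]
  rw [h1, h2]
  simp only [eval_mul, eval_C, eval_pow, eval_X, map_mul, map_pow]
  rw [h3]
  linear_combination (-(starRingEnd ℂ) (P.coeff j) * z ^ (n - j)) * h4

theorem natDegree_revStar_le (n : ℕ) (P : ℂ[X]) : (revStar n P).natDegree ≤ n := by
  refine natDegree_sum_le_of_forall_le _ _ fun j hj => ?_
  exact (natDegree_C_mul_X_pow_le _ _).trans (by simpa [Nat.lt_succ_iff] using hj)

theorem coeff_zero_revStar (n : ℕ) (P : ℂ[X]) :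
    (revStar n P).coeff 0 = (starRingEnd ℂ) (P.coeff n) := by
  rw [revStar, finsetSum_coeff, Finset.sum_eq_single 0]
  · simp
  · intro j _ hj
    simp [coeff_X_pow, hj.symm]
  · simp

theorem revStar_C_mul_add (n : ℕ) (c : ℂ) (A B : ℂ[X]) :
    revStar n (C c * A + B) = C ((starRingEnd ℂ) c) * revStar n A + revStar n B := by
  simp only [revStar, Finset.mul_sum, ← Finset.sum_add_distrib]
  refine Finset.sum_congr rfl fun j _ => ?_
  simp only [coeff_add, coeff_C_mul, map_add, map_mul]
  ring

/-- The Szegő recursion. -/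
theorem IsMonicOPUC.szego_recursion {μ : Measure ℂ} (hμ : IsNontrivialOnCircle μ)
    {Φ : ℕ → ℂ[X]} (hΦ : IsMonicOPUC μ Φ) (n : ℕ) :
    Φ (n + 1) = X * Φ n + C ((Φ (n + 1)).eval 0) * revStar n (Φ n) := by
  obtain ⟨⟨hmon, hdeg⟩, horth⟩ := hΦ n
  obtain ⟨⟨hmon', hdeg'⟩, horth'⟩ := hΦ (n + 1)
  set c := (Φ (n + 1)).eval 0 with hc
  set R := Φ (n + 1) - (X * Φ n + C c * revStar n (Φ n)) with hR
  have hlead : (Φ n).coeff n = 1 := by simpa [hdeg] using hmon.coeff_natDegree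
  have hlead' : (Φ (n + 1)).coeff (n + 1) = 1 := by simpa [hdeg'] using hmon'.coeff_natDegree
  have hzero : R.coeff 0 = 0 := by
    rw [hR, coeff_sub, coeff_add, coeff_X_mul_zero, coeff_C_mul, coeff_zero_revStar, hlead,
      coeff_zero_eq_eval_zero, ← hc]
    simp
  have hhigh : ∀ j, n < j → R.coeff j = 0 := by
    intro j hj
    have hs : (revStar n (Φ n)).coeff j = 0 :=
      coeff_eq_zero_of_natDegree_lt ((natDegree_revStar_le n _).trans_lt hj)
    obtain ⟨k, rfl⟩ : ∃ k, j = k + 1 := ⟨j - 1, by omega⟩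
    rw [hR, coeff_sub, coeff_add, coeff_X_mul, coeff_C_mul, hs]
    rcases Nat.eq_or_lt_of_le (Nat.lt_succ_iff.1 hj) with rfl | hk
    · simp [hlead, hlead']
    · rw [coeff_eq_zero_of_natDegree_lt (by omega), coeff_eq_zero_of_natDegree_lt (by omega)]
      simp
  refine sub_eq_zero.1 (hμ.eq_zero_of_orthogonal R fun j hj => ?_)
  have hj0 : j ≠ 0 := fun h => mem_support_iff.1 hj (h ▸ hzero)
  have hjn : j ≤ n := not_lt.1 fun h => mem_support_iff.1 hj (hhigh j h)
  have hcongr : ∀ᵐ z ∂μ, (starRingEnd ℂ) z ^ j * R.eval z =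
      (starRingEnd ℂ) z ^ j * (Φ (n + 1)).eval z -
        ((starRingEnd ℂ) z ^ (j - 1) * (Φ n).eval z +
          c * (starRingEnd ℂ) ((starRingEnd ℂ) z ^ (n - j) * (Φ n).eval z)) := by
    filter_upwards [hμ.ae_norm_eq_one] with z hz
    have hzz : z * (starRingEnd ℂ) z = 1 := by simp [Complex.mul_conj', hz]
    have h1 : (starRingEnd ℂ) z ^ j * z = (starRingEnd ℂ) z ^ (j - 1) := by
      obtain ⟨k, rfl⟩ : ∃ k, j = k + 1 := ⟨j - 1, by omega⟩
      rw [Nat.add_sub_cancel, pow_succ]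
      linear_combination (starRingEnd ℂ) z ^ k * hzz
    have h2 : (starRingEnd ℂ) z ^ j * z ^ n = z ^ (n - j) := by
      have h3 : z ^ n = z ^ j * z ^ (n - j) := by rw [← pow_add]; congr 1; omega
      have h4 : z ^ j * (starRingEnd ℂ) z ^ j = 1 := by rw [← mul_pow, hzz, one_pow]
      rw [h3]
      linear_combination z ^ (n - j) * h4
    rw [hR]
    simp only [eval_sub, eval_add, eval_mul, eval_X, eval_C, map_mul, map_pow,
      Complex.conj_conj, eval_revStar hdeg.le hz]
    linear_combination (-(Φ n).eval z) * h1 - c * (starRingEnd ℂ) ((Φ n).eval z) * h2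
  rw [integral_congr_ae hcongr, integral_sub, integral_add, integral_const_mul, integral_conj,
    horth' j (by omega), horth (j - 1) (by omega), horth (n - j) (by omega)]
  · simp
  all_goals exact hμ.integrable_of_continuous (by fun_prop)

/-- The data of an Aleksandrov family. -/
def IsAleksandrovFamily (α : ℕ → ℂ) (μfam : ℂ → Measure ℂ) (Φfam : ℂ → ℕ → ℂ[X]) : Prop :=
  ∀ l : ℂ, ‖l‖ = 1 →
    IsNontrivialOnCircle (μfam l) ∧ IsMonicOPUC (μfam l) (Φfam l) ∧
      ∀ j, verblunsky (Φfam l) j = l * α j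

namespace IsAleksandrovFamily

variable {α : ℕ → ℂ} {μfam : ℂ → Measure ℂ} {Φfam : ℂ → ℕ → ℂ[X]}

theorem eval_zero (h : IsAleksandrovFamily α μfam Φfam) {l : ℂ} (hl : ‖l‖ = 1) (n : ℕ) :
    (Φfam l (n + 1)).eval 0 = -((starRingEnd ℂ) l * (starRingEnd ℂ) (α n)) := by
  have := congrArg (starRingEnd ℂ) ((h l hl).2.2 n)
  rw [verblunsky, map_neg, Complex.conj_conj, map_mul] at this
  linear_combination -this

/-- The orthogonal polynomials of an Aleksandrov family are affine in `conj l`. -/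
theorem exists_affine (h : IsAleksandrovFamily α μfam Φfam) (n : ℕ) :
    ∃ A B : ℂ[X], ∀ l : ℂ, ‖l‖ = 1 → Φfam l n = C ((starRingEnd ℂ) l) * A + B := by
  induction n with
  | zero =>
    refine ⟨0, 1, fun l hl => ?_⟩
    obtain ⟨hm, hd⟩ := ((h l hl).2.1 0).1
    simpa using hm.natDegree_eq_zero.1 hd
  | succ n ih =>
    obtain ⟨A, B, hAB⟩ := ih
    refine ⟨X * A - C ((starRingEnd ℂ) (α n)) * revStar n B,
      X * B - C ((starRingEnd ℂ) (α n)) * revStar n A, fun l hl => ?_⟩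
    have hll : C ((starRingEnd ℂ) l) * C l = 1 := by
      rw [← C_mul, Complex.conj_mul', hl]
      simp
    rw [(h l hl).2.1.szego_recursion (h l hl).1 n, h.eval_zero hl, hAB l hl, revStar_C_mul_add,
      Complex.conj_conj, C_neg, C_mul]
    linear_combination (-C ((starRingEnd ℂ) (α n)) * revStar n A) * hll

/-- The moments of an Aleksandrov family are polynomials in `conj l` without constant term. -/
theorem exists_moment (h : IsAleksandrovFamily α μfam Φfam) (n : ℕ) :
    ∃ P : ℂ[X], P.eval 0 = 0 ∧ ∀ l : ℂ, ‖l‖ = 1 →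
      ∫ z, z ^ (n + 1) ∂(μfam l) = P.eval ((starRingEnd ℂ) l) := by
  induction n using Nat.strong_induction_on with
  | _ n ih =>
    choose! P hP0 hP using ih
    obtain ⟨A, B, hAB⟩ := h.exists_affine (n + 1)
    refine ⟨X * C ((starRingEnd ℂ) (α n)) -
      ∑ k ∈ Finset.range n, (X * C (A.coeff (k + 1)) + C (B.coeff (k + 1))) * P k, ?_, ?_⟩
    · simp only [eval_sub, eval_mul, eval_X, zero_mul, eval_finsetSum, zero_sub, neg_eq_zero]
      refine Finset.sum_eq_zero fun k hk => ?_
      rw [hP0 k (Finset.mem_range.1 hk), mul_zero]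
    · intro l hl
      obtain ⟨hμ, hΦ, -⟩ := h l hl
      have := hμ.prob
      obtain ⟨⟨hmon, hdeg⟩, horth⟩ := hΦ (n + 1)
      have h0 := horth 0 n.succ_pos
      have hlead : (Φfam l (n + 1)).coeff (n + 1) = 1 := by
        simpa [hdeg] using hmon.coeff_natDegree
      simp only [pow_zero, one_mul, eval_eq_sum_range, hdeg] at h0
      rw [integral_finsetSum _ fun k _ => hμ.integrable_of_continuous (by fun_prop)] at h0
      simp only [integral_const_mul] at h0
      rw [Finset.sum_range_succ, Finset.sum_range_succ', hlead, coeff_zero_eq_eval_zero,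
        h.eval_zero hl] at h0
      have hsum : ∑ k ∈ Finset.range n,
          (Φfam l (n + 1)).coeff (k + 1) * ∫ z, z ^ (k + 1) ∂(μfam l) =
          ∑ k ∈ Finset.range n, ((starRingEnd ℂ) l * A.coeff (k + 1) + B.coeff (k + 1)) *
            (P k).eval ((starRingEnd ℂ) l) := by
        refine Finset.sum_congr rfl fun k hk => ?_
        rw [hP k (Finset.mem_range.1 hk) l hl, hAB l hl, coeff_add, coeff_C_mul]
      rw [hsum] at h0
      simp only [eval_sub, eval_mul, eval_X, eval_C, eval_add, eval_finsetSum]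
      simp only [pow_zero, integral_const, probReal_univ, one_smul] at h0
      linear_combination h0

end IsAleksandrovFamily

theorem norm_exp_I_mul (θ : ℝ) : ‖Complex.exp (Complex.I * θ)‖ = 1 := by
  rw [mul_comm, Complex.norm_exp_ofReal_mul_I]

theorem integral_exp_I_mul_pow (n : ℕ) :
    ∫ θ in (0 : ℝ)..(2 * Real.pi), Complex.exp (Complex.I * θ) ^ (n + 1) = 0 := by
  have hc : ((n + 1 : ℕ) : ℂ) * Complex.I ≠ 0 :=
    mul_ne_zero (Nat.cast_ne_zero.2 n.succ_ne_zero) Complex.I_ne_zero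
  have : ∀ θ : ℝ, Complex.exp (Complex.I * θ) ^ (n + 1) =
      Complex.exp (((n + 1 : ℕ) : ℂ) * Complex.I * θ) := by
    intro θ
    rw [← Complex.exp_nat_mul, mul_assoc]
  simp_rw [this]
  rw [integral_exp_mul_complex hc, Complex.ofReal_zero, mul_zero, Complex.exp_zero]
  have h1 : ((n + 1 : ℕ) : ℂ) * Complex.I * ((2 * Real.pi : ℝ) : ℂ) =
      ((n + 1 : ℕ) : ℂ) * (2 * Real.pi * Complex.I) := by
    push_cast
    ring
  rw [h1, Complex.exp_nat_mul_two_pi_mul_I, sub_self, zero_div]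

theorem intervalIntegral_conj (f : ℝ → ℂ) (a b : ℝ) :
    ∫ θ in a..b, (starRingEnd ℂ) (f θ) = (starRingEnd ℂ) (∫ θ in a..b, f θ) := by
  simp only [intervalIntegral, integral_conj, map_sub]

theorem integral_eval_conj_exp (P : ℂ[X]) :
    ∫ θ in (0 : ℝ)..(2 * Real.pi), P.eval ((starRingEnd ℂ) (Complex.exp (Complex.I * θ))) =
      2 * Real.pi * P.eval 0 := by
  induction P using Polynomial.induction_on' with
  | add p q hp hq =>
    simp only [eval_add]
    rw [intervalIntegral.integral_add, hp, hq, mul_add]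
    all_goals exact Continuous.intervalIntegrable (by fun_prop) _ _
  | monomial n a =>
    simp only [eval_monomial]
    rw [intervalIntegral.integral_const_mul]
    cases n with
    | zero => simp [mul_comm]
    | succ n =>
      simp only [← map_pow]
      rw [intervalIntegral_conj, integral_exp_I_mul_pow]
      simp

/-- The functions for which the averaging identity holds and the average is well behaved. -/
structure IsAveraged (μfam : ℂ → Measure ℂ) (q : ℂ → ℂ) : Prop where
  continuous : Continuous q
  continuous_integral :
    Continuous fun θ : ℝ => ∫ w, q w ∂(μfam (Complex.exp (Complex.I * θ)))
  average_eq :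
    ∫ θ in (0 : ℝ)..(2 * Real.pi), ∫ w, q w ∂(μfam (Complex.exp (Complex.I * θ))) =
      ∫ θ in (0 : ℝ)..(2 * Real.pi), q (Complex.exp (Complex.I * θ))

namespace IsAveraged

variable {μfam : ℂ → Measure ℂ} {p q : ℂ → ℂ}

theorem const (hfam : ∀ l : ℂ, ‖l‖ = 1 → IsNontrivialOnCircle (μfam l)) (c : ℂ) :
    IsAveraged μfam fun _ => c := by
  have h : ∀ θ : ℝ, ∫ _, c ∂(μfam (Complex.exp (Complex.I * θ))) = c := by
    intro θ
    have := (hfam _ (norm_exp_I_mul θ)).prob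
    simp
  exact ⟨continuous_const, by simpa only [h] using continuous_const, by simp only [h]⟩

theorem const_mul (hq : IsAveraged μfam q) (c : ℂ) : IsAveraged μfam fun w => c * q w := by
  refine ⟨continuous_const.mul hq.continuous, ?_, ?_⟩
  · simp only [integral_const_mul]
    exact continuous_const.mul hq.continuous_integral
  · simp only [integral_const_mul, intervalIntegral.integral_const_mul, hq.average_eq]

theorem conj (hq : IsAveraged μfam q) : IsAveraged μfam fun w => (starRingEnd ℂ) (q w) := by
  refine ⟨Complex.continuous_conj.comp hq.continuous, ?_, ?_⟩
  · simp only [integral_conj]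
    exact Complex.continuous_conj.comp hq.continuous_integral
  · simp only [integral_conj, intervalIntegral_conj, hq.average_eq]

theorem add (hfam : ∀ l : ℂ, ‖l‖ = 1 → IsNontrivialOnCircle (μfam l))
    (hp : IsAveraged μfam p) (hq : IsAveraged μfam q) : IsAveraged μfam fun w => p w + q w := by
  have h : ∀ θ : ℝ, ∫ w, p w + q w ∂(μfam (Complex.exp (Complex.I * θ))) =
      (∫ w, p w ∂(μfam (Complex.exp (Complex.I * θ)))) +
        ∫ w, q w ∂(μfam (Complex.exp (Complex.I * θ))) := fun θ =>
    integral_add ((hfam _ (norm_exp_I_mul θ)).integrable_of_continuous hp.continuous)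
      ((hfam _ (norm_exp_I_mul θ)).integrable_of_continuous hq.continuous)
  refine ⟨hp.continuous.add hq.continuous, ?_, ?_⟩
  · simp only [h]
    exact hp.continuous_integral.add hq.continuous_integral
  · simp only [h]
    rw [intervalIntegral.integral_add (hp.continuous_integral.intervalIntegrable _ _)
      (hq.continuous_integral.intervalIntegrable _ _), hp.average_eq, hq.average_eq,
      intervalIntegral.integral_add]
    · exact (hp.continuous.comp (by fun_prop)).intervalIntegrable _ _
    · exact (hq.continuous.comp (by fun_prop)).intervalIntegrable _ _

theorem pow {α : ℕ → ℂ} {Φfam : ℂ → ℕ → ℂ[X]} (h : IsAleksandrovFamily α μfam Φfam) (n : ℕ) :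
    IsAveraged μfam fun w => w ^ n := by
  cases n with
  | zero => simpa using const (fun l hl => (h l hl).1) 1
  | succ n =>
    obtain ⟨P, hP0, hP⟩ := h.exists_moment n
    have hm : ∀ θ : ℝ, ∫ w, w ^ (n + 1) ∂(μfam (Complex.exp (Complex.I * θ))) =
        P.eval ((starRingEnd ℂ) (Complex.exp (Complex.I * θ))) := fun θ => hP _ (norm_exp_I_mul θ)
    refine ⟨by fun_prop, ?_, ?_⟩
    · simp only [hm]
      fun_prop
    · simp only [hm]
      rw [integral_eval_conj_exp, hP0, mul_zero, integral_exp_I_mul_pow]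

/-- Functions which are averaged on the unit circle are closed under uniform limits. -/
theorem of_approx (hfam : ∀ l : ℂ, ‖l‖ = 1 → IsNontrivialOnCircle (μfam l)) {g : ℂ → ℂ}
    (hg : Continuous g)
    (happ : ∀ ε > 0, ∃ q, IsAveraged μfam q ∧ ∀ z : ℂ, ‖z‖ = 1 → ‖g z - q z‖ ≤ ε) :
    IsAveraged μfam g := by
  have hclose : ∀ ε > 0, ∃ q, IsAveraged μfam q ∧ (∀ z : ℂ, ‖z‖ = 1 → ‖g z - q z‖ ≤ ε) ∧
      ∀ θ : ℝ, ‖(∫ w, g w ∂(μfam (Complex.exp (Complex.I * θ)))) -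
        ∫ w, q w ∂(μfam (Complex.exp (Complex.I * θ)))‖ ≤ ε := by
    intro ε hε
    obtain ⟨q, hq, hgq⟩ := happ ε hε
    refine ⟨q, hq, hgq, fun θ => ?_⟩
    have hθ := hfam _ (norm_exp_I_mul θ)
    have := hθ.prob
    rw [← integral_sub (hθ.integrable_of_continuous hg)
      (hθ.integrable_of_continuous hq.continuous)]
    have hae : ∀ᵐ w ∂(μfam (Complex.exp (Complex.I * θ))), ‖g w - q w‖ ≤ ε := by
      filter_upwards [hθ.ae_norm_eq_one] with w hw using hgq w hw
    simpa using norm_integral_le_of_norm_le_const hae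
  have hcont : Continuous fun θ : ℝ => ∫ w, g w ∂(μfam (Complex.exp (Complex.I * θ))) := by
    refine continuous_of_uniform_approx_of_continuous fun u hu => ?_
    obtain ⟨ε, hε, hεu⟩ := Metric.mem_uniformity_dist.1 hu
    obtain ⟨q, hq, -, hIntegral⟩ := hclose (ε / 2) (half_pos hε)
    refine ⟨_, hq.continuous_integral, fun θ => hεu ?_⟩
    rw [dist_eq_norm]
    exact (hIntegral θ).trans_lt (half_lt_self hε)
  refine ⟨hg, hcont, ?_⟩
  rw [← sub_eq_zero, ← norm_le_zero_iff]
  refine le_of_forall_pos_le_add fun δ hδ => ?_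
  rw [zero_add]
  obtain ⟨q, hq, hgq, hIntegral⟩ := hclose (δ / (4 * Real.pi)) (by positivity)
  have h1 := intervalIntegral.norm_integral_le_of_norm_le_const (a := 0) (b := 2 * Real.pi)
    fun θ _ => hIntegral θ
  have h2 := intervalIntegral.norm_integral_le_of_norm_le_const (a := 0) (b := 2 * Real.pi)
    fun θ _ => hgq _ (norm_exp_I_mul θ)
  rw [intervalIntegral.integral_sub (hcont.intervalIntegrable _ _)
    (hq.continuous_integral.intervalIntegrable _ _), hq.average_eq] at h1
  rw [intervalIntegral.integral_sub] at h2
  · have hπ : δ / (4 * Real.pi) * |2 * Real.pi - 0| = δ / 2 := by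
      rw [sub_zero, abs_of_pos Real.two_pi_pos]
      field_simp
      norm_num
    rw [hπ] at h1 h2
    rw [norm_sub_rev] at h2
    linarith [norm_sub_le_norm_sub_add_norm_sub
      (∫ θ in (0 : ℝ)..(2 * Real.pi), ∫ w, g w ∂(μfam (Complex.exp (Complex.I * θ))))
      (∫ θ in (0 : ℝ)..(2 * Real.pi), q (Complex.exp (Complex.I * θ)))
      (∫ θ in (0 : ℝ)..(2 * Real.pi), g (Complex.exp (Complex.I * θ)))]
  · exact (hg.comp (by fun_prop)).intervalIntegrable _ _
  · exact (hq.continuous.comp (by fun_prop)).intervalIntegrable _ _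

theorem of_mem_span_fourier {α : ℕ → ℂ} {Φfam : ℂ → ℕ → ℂ[X]}
    (h : IsAleksandrovFamily α μfam Φfam) {F : C(AddCircle (1 : ℝ), ℂ)}
    (hF : F ∈ Submodule.span ℂ (Set.range (fourier (T := (1 : ℝ))))) :
    ∃ q, IsAveraged μfam q ∧ ∀ x, F x = q (AddCircle.toCircle x) := by
  have hfam : ∀ l : ℂ, ‖l‖ = 1 → IsNontrivialOnCircle (μfam l) := fun l hl => (h l hl).1
  induction hF using Submodule.span_induction with
  | mem F hF =>
    obtain ⟨n, rfl⟩ := hF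
    obtain ⟨k, rfl | rfl⟩ := n.eq_nat_or_neg
    · refine ⟨_, pow h k, fun x => ?_⟩
      simp [fourier_apply, AddCircle.toCircle_nsmul]
    · refine ⟨_, (pow h k).conj, fun x => ?_⟩
      rw [fourier_neg]
      simp [fourier_apply, AddCircle.toCircle_nsmul]
  | zero => exact ⟨_, const hfam 0, fun _ => rfl⟩
  | add F G _ _ hF hG =>
    obtain ⟨p, hp, hFp⟩ := hF
    obtain ⟨q, hq, hGq⟩ := hG
    exact ⟨_, hp.add hfam hq, fun x => by simp [hFp, hGq]⟩
  | smul c F _ hF =>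
    obtain ⟨p, hp, hFp⟩ := hF
    exact ⟨_, hp.const_mul c, fun x => by simp [hFp]⟩

theorem of_continuous {α : ℕ → ℂ} {Φfam : ℂ → ℕ → ℂ[X]}
    (h : IsAleksandrovFamily α μfam Φfam) {g : ℂ → ℂ} (hg : Continuous g) :
    IsAveraged μfam g := by
  refine of_approx (fun l hl => (h l hl).1) hg fun ε hε => ?_
  let G : C(AddCircle (1 : ℝ), ℂ) :=
    ⟨fun x => g (AddCircle.toCircle x),
      hg.comp (continuous_subtype_val.comp AddCircle.continuous_toCircle)⟩
  have hG : G ∈ closure (Submodule.span ℂ (Set.range (fourier (T := (1 : ℝ)))) : Set _) := by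
    rw [← Submodule.topologicalClosure_coe, span_fourier_closure_eq_top]
    trivial
  obtain ⟨F, hF, hGF⟩ := Metric.mem_closure_iff.1 hG ε hε
  obtain ⟨q, hq, hFq⟩ := of_mem_span_fourier h hF
  refine ⟨q, hq, fun z hz => ?_⟩
  obtain ⟨x, hx⟩ := (AddCircle.homeomorphCircle (one_ne_zero (α := ℝ))).surjective
    ⟨z, mem_sphere_zero_iff_norm.2 hz⟩
  have hxz : (AddCircle.toCircle x : ℂ) = z := by
    rw [← AddCircle.homeomorphCircle_apply (one_ne_zero (α := ℝ)), hx]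
  have hle := (ContinuousMap.dist_apply_le_dist (f := G) (g := F) x).trans hGF.le
  rw [dist_eq_norm, hFq, hxz] at hle
  simpa [G, hxz] using hle

end IsAveraged

/-- Aleksandrov, Golinskii: averaging the Aleksandrov family
`μ_λ` (with `α_j(dμ_λ) = λ α_j(dμ)`) over `λ = e^{iθ} ∈ ∂𝔻` gives normalized
Lebesgue measure. -/
theorem stmt14 (μ : Measure ℂ) (hμ : IsNontrivialOnCircle μ)
    (Φ : ℕ → Polynomial ℂ) (hΦ : IsMonicOPUC μ Φ)
    (μfam : ℂ → Measure ℂ) (Φfam : ℂ → ℕ → Polynomial ℂ)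
    (hfam : ∀ l : ℂ, ‖l‖ = 1 →
      IsNontrivialOnCircle (μfam l) ∧ IsMonicOPUC (μfam l) (Φfam l) ∧
      ∀ j, verblunsky (Φfam l) j = l * verblunsky Φ j) :
    ∀ g : ℂ → ℂ, Continuous g →
      ((2 * Real.pi : ℂ))⁻¹ *
          ∫ θ in (0:ℝ)..(2 * Real.pi), ∫ w, g w ∂(μfam (Complex.exp (Complex.I * θ)))
        = ((2 * Real.pi : ℂ))⁻¹ *
            ∫ θ in (0:ℝ)..(2 * Real.pi), g (Complex.exp (Complex.I * θ)) := by
  intro g hg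
  rw [(IsAveraged.of_continuous (α := verblunsky Φ) hfam hg).average_eq]

end
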